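/- For all m ≥ 1 and n ≥ 1, the absolute order abs(G(m,1,n)) has a coarsening isomorphic to the product of claw posets C_m × C_{2m} × ⋯ × C_{nm}: there is a bijection φ from C_m × C_{2m} × ⋯ × C_{nm} onto G(m,1,n) such that the rank of x in the product poset equals ℓ_R(φ(x)) for every x, and x ≤ y in the product poset implies φ(x) ≤ φ(y) in abs(G(m,1,n)). -/

import Mathlib

open Module Set

noncomputable section

variable {V : Type*} [AddCommGroup V] [Module ℂ V]

/-- The codimension of the fixed subspace of a linear automorphism. -/
def fixCodim (w : V ≃ₗ[ℂ] V) : ℕ :=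
  finrank ℂ V - finrank ℂ (LinearMap.ker ((w : V →ₗ[ℂ] V) - 1))

/-- A reflection: fixed space has codimension one. -/
def IsReflection (w : V ≃ₗ[ℂ] V) : Prop := fixCodim w = 1

/-- A finite subgroup of GL(V) generated by its reflections. -/
def IsComplexReflectionGroup (W : Set (V ≃ₗ[ℂ] V)) : Prop :=
  W.Finite ∧ W = (Subgroup.closure {t | t ∈ W ∧ IsReflection t} : Subgroup (V ≃ₗ[ℂ] V))

/-- Reflection length with respect to the reflections of `W`. -/
def reflLen (W : Set (V ≃ₗ[ℂ] V)) (w : V ≃ₗ[ℂ] V) : ℕ :=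
  sInf {k | ∃ l : List (V ≃ₗ[ℂ] V), l.length = k ∧
    (∀ t ∈ l, t ∈ W ∧ IsReflection t) ∧ l.prod = w}

/-- The prefix order relation. -/
def preLe (W : Set (V ≃ₗ[ℂ] V)) (u v : V ≃ₗ[ℂ] V) : Prop :=
  reflLen W u + reflLen W (u⁻¹ * v) = reflLen W v

/-- The codimension order relation. -/
def coLe (u v : V ≃ₗ[ℂ] V) : Prop :=
  fixCodim u + fixCodim (u⁻¹ * v) = fixCodim v

/-- The group `G(m,p,n)` of monomial matrices with `m`-th root of unity entries whose
product is an `(m/p)`-th root of unity, as linear automorphisms of `ℂⁿ`. -/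
def Gmpn (m p n : ℕ) : Set ((Fin n → ℂ) ≃ₗ[ℂ] (Fin n → ℂ)) :=
  {w | ∃ (σ : Equiv.Perm (Fin n)) (a : Fin n → ℂ),
    (∀ i, a i ^ m = 1) ∧ (∏ i, a i) ^ (m / p) = 1 ∧
    ∀ j, w (Pi.single j (1 : ℂ)) = a j • (Pi.single (σ j) (1 : ℂ) : Fin n → ℂ)}

section Poset

variable {α : Type*}

/-- An antichain of the poset on carrier `P` with order relation `le`. -/
def IsAntichainOn (P : Set α) (le : α → α → Prop) (A : Set α) : Prop :=
  A ⊆ P ∧ ∀ x ∈ A, ∀ y ∈ A, x ≠ y → ¬ le x y ∧ ¬ le y x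

/-- `k`-Sperner: no union of `k` antichains is larger than the union of some `k` ranks
(equivalently, of the `k` largest ranks). -/
def IsKSpernerOn (P : Set α) (le : α → α → Prop) (rk : α → ℕ) (k : ℕ) : Prop :=
  ∀ 𝒜 : Fin k → Set α, (∀ i, IsAntichainOn P le (𝒜 i)) →
    ∃ S : Finset ℕ, S.card ≤ k ∧ (⋃ i, 𝒜 i).ncard ≤ {x | x ∈ P ∧ rk x ∈ S}.ncard

def IsStronglySpernerOn (P : Set α) (le : α → α → Prop) (rk : α → ℕ) : Prop :=
  ∀ k, IsKSpernerOn P le rk k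

/-- Sperner: no antichain is larger than some (equivalently, the largest) rank. -/
def IsSpernerOn (P : Set α) (le : α → α → Prop) (rk : α → ℕ) : Prop :=
  ∀ A : Set α, IsAntichainOn P le A → ∃ i, A.ncard ≤ {x | x ∈ P ∧ rk x = i}.ncard

/-- Covering relation of the poset on carrier `P`. -/
def CoversOn (P : Set α) (le : α → α → Prop) (x y : α) : Prop :=
  x ∈ P ∧ y ∈ P ∧ le x y ∧ x ≠ y ∧ ∀ z ∈ P, le x z → le z y → z = x ∨ z = y

/-- A normalized flow on the bipartite graph with parts `A`, `B`, edge relation `E`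
and vertex weights `ν`. -/
def IsNormalizedFlowBetween (A B : Set α) (E : α → α → Prop) (ν : α → ℝ)
    (f : α → α → ℝ) : Prop :=
  (∀ a b, 0 ≤ f a b) ∧
  (∀ a b, f a b ≠ 0 → a ∈ A ∧ b ∈ B ∧ E a b) ∧
  (∀ a ∈ A, (∑ᶠ b ∈ B, f a b) = ν a / ∑ᶠ x ∈ A, ν x) ∧
  (∀ b ∈ B, (∑ᶠ a ∈ A, f a b) = ν b / ∑ᶠ x ∈ B, ν x)

/-- A ranked poset has a normalized flow if each bipartite graph of covering relations
between consecutive ranks admits one. -/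
def HasNormalizedFlowOn (P : Set α) (le : α → α → Prop) (rk : α → ℕ) (ν : α → ℝ) : Prop :=
  ∀ i : ℕ, ∃ f, IsNormalizedFlowBetween {x | x ∈ P ∧ rk x = i} {x | x ∈ P ∧ rk x = i + 1}
    (CoversOn P le) ν f

end Poset


/-- The rank of an element of the product of claw posets `C_m × C_{2m} × ⋯ × C_{nm}`,
where the claw poset `C_N` is modelled on `Fin N` with bottom element `0` and all other
elements of rank `1`. -/
def clawRank {n m : ℕ} (x : ∀ j : Fin n, Fin ((j.1 + 1) * m)) : ℕ :=
  {j | (x j : ℕ) ≠ 0}.ncard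

/-- The componentwise order on the product of claw posets `C_m × C_{2m} × ⋯ × C_{nm}`. -/
def clawLe {n m : ℕ} (x y : ∀ j : Fin n, Fin ((j.1 + 1) * m)) : Prop :=
  ∀ j, x j = y j ∨ (x j : ℕ) = 0

section Codimension

variable [FiniteDimensional ℂ V]

theorem fixCodim_eq_finrank_range (w : V ≃ₗ[ℂ] V) :
    fixCodim w = finrank ℂ (LinearMap.range ((w : V →ₗ[ℂ] V) - 1)) := by
  have h := LinearMap.finrank_range_add_finrank_ker ((w : V →ₗ[ℂ] V) - 1)
  unfold fixCodim
  omega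

theorem fixCodim_one : fixCodim (1 : V ≃ₗ[ℂ] V) = 0 := by
  have h : ((1 : V ≃ₗ[ℂ] V) : V →ₗ[ℂ] V) - 1 = 0 := by
    ext v
    simp
  rw [fixCodim_eq_finrank_range, h, LinearMap.range_zero, finrank_bot]

theorem eq_one_of_fixCodim_eq_zero {w : V ≃ₗ[ℂ] V} (h : fixCodim w = 0) : w = 1 := by
  rw [fixCodim_eq_finrank_range, Submodule.finrank_eq_zero, LinearMap.range_eq_bot] at h
  ext v
  simpa [sub_eq_zero] using LinearMap.congr_fun h v

theorem fixCodim_mul_le (u v : V ≃ₗ[ℂ] V) : fixCodim (u * v) ≤ fixCodim u + fixCodim v := by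
  simp only [fixCodim_eq_finrank_range]
  refine (Submodule.finrank_mono ?_).trans
    (Submodule.finrank_add_le_finrank_add_finrank _ _)
  rintro _ ⟨x, rfl⟩
  refine Submodule.mem_sup.2 ⟨_, ⟨v x, rfl⟩, _, ⟨x, rfl⟩, ?_⟩
  simp

theorem fixCodim_conj_le (g t : V ≃ₗ[ℂ] V) : fixCodim (g⁻¹ * t * g) ≤ fixCodim t := by
  simp only [fixCodim_eq_finrank_range]
  refine (Submodule.finrank_mono ?_).trans
    (Submodule.finrank_map_le ((g⁻¹ : V ≃ₗ[ℂ] V) : V →ₗ[ℂ] V) _)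
  rintro _ ⟨x, rfl⟩
  refine ⟨_, ⟨g x, rfl⟩, ?_⟩
  simp

theorem fixCodim_conj (g t : V ≃ₗ[ℂ] V) : fixCodim (g⁻¹ * t * g) = fixCodim t := by
  refine le_antisymm (fixCodim_conj_le g t) ?_
  have h := fixCodim_conj_le g⁻¹ (g⁻¹ * t * g)
  rwa [show g⁻¹⁻¹ * (g⁻¹ * t * g) * g⁻¹ = t by group] at h

theorem fixCodim_list_prod_le (l : List (V ≃ₗ[ℂ] V)) (hl : ∀ t ∈ l, IsReflection t) :
    fixCodim l.prod ≤ l.length := by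
  induction l with
  | nil => simp [fixCodim_one]
  | cons t l ih =>
    have h := fixCodim_mul_le t l.prod
    have ht : fixCodim t = 1 := hl t (by simp)
    have := ih fun s hs => hl s (by simp [hs])
    simp only [List.prod_cons, List.length_cons]
    omega

end Codimension

theorem reflLen_le {W : Set (V ≃ₗ[ℂ] V)} {w : V ≃ₗ[ℂ] V} {l : List (V ≃ₗ[ℂ] V)}
    (hl : ∀ t ∈ l, t ∈ W ∧ IsReflection t) (hw : l.prod = w) : reflLen W w ≤ l.length :=
  Nat.sInf_le ⟨l, rfl, hl, hw⟩

theorem fixCodim_le_reflLen [FiniteDimensional ℂ V] {W : Set (V ≃ₗ[ℂ] V)} {w : V ≃ₗ[ℂ] V}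
    {l : List (V ≃ₗ[ℂ] V)} (hl : ∀ t ∈ l, t ∈ W ∧ IsReflection t) (hw : l.prod = w) :
    fixCodim w ≤ reflLen W w := by
  obtain ⟨l', h, hl', rfl⟩ : reflLen W w ∈ {k | ∃ l : List (V ≃ₗ[ℂ] V), l.length = k ∧
    (∀ t ∈ l, t ∈ W ∧ IsReflection t) ∧ l.prod = w} := Nat.sInf_mem ⟨_, l, rfl, hl, hw⟩
  rw [← h]
  exact fixCodim_list_prod_le l' fun t ht => (hl' t ht).2

open Classical in
/-- If `g` arises from `h` by replacing some terms by `1`, then the product of `h` is the product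
of `g` times a product of conjugates of the deleted terms. -/
theorem exists_list_prod_eq_inv_mul {G : Type*} [Group G] (T : Set G) (g h : ℕ → G)
    (hT : ∀ k, ∀ t ∈ T, (g k)⁻¹ * t * g k ∈ T) (hh : ∀ k, h k = 1 ∨ h k ∈ T)
    (hgh : ∀ k, g k = h k ∨ g k = 1) (N : ℕ) :
    ∃ l : List G, l.length = ∑ k ∈ Finset.range N, (if g k = h k then 0 else 1) ∧
      (∀ t ∈ l, t ∈ T) ∧
      l.prod = ((List.range N).map g).prod⁻¹ * ((List.range N).map h).prod := by
  induction N with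
  | zero => exact ⟨[], by simp⟩
  | succ N ih =>
    obtain ⟨l, hl, hlT, hp⟩ := ih
    simp only [Finset.sum_range_succ, List.range_succ, List.map_append, List.prod_append,
      List.map_cons, List.map_nil, List.prod_singleton]
    by_cases e : g N = h N
    · refine ⟨l.map (MulAut.conj (g N)⁻¹), by simp [hl, e], ?_, ?_⟩
      · simp only [List.mem_map]
        rintro _ ⟨t, ht, rfl⟩
        simpa using hT N t (hlT t ht)
      · rw [← map_list_prod, hp, ← e]
        simp [mul_assoc]
    · have g1 := (hgh N).resolve_left e
      refine ⟨l ++ [h N], by simp [hl, e], ?_, ?_⟩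
      · simp only [List.mem_append, List.mem_singleton]
        rintro t (ht | rfl)
        · exact hlT t ht
        · exact (hh N).resolve_left fun h1 => e (g1.trans h1.symm)
      · simp [hp, g1, mul_assoc]

section Monomial

variable {m n : ℕ}

theorem mem_Gmpn_one_iff {w : (Fin n → ℂ) ≃ₗ[ℂ] (Fin n → ℂ)} :
    w ∈ Gmpn m 1 n ↔ ∃ (σ : Equiv.Perm (Fin n)) (a : Fin n → ℂ),
      (∀ i, a i ^ m = 1) ∧ ∀ v j, w v (σ j) = a j * v j := by
  constructor
  · rintro ⟨σ, a, ha, -, h⟩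
    refine ⟨σ, a, ha, fun v j => ?_⟩
    have hv : v = ∑ k, v k • (Pi.single k (1 : ℂ) : Fin n → ℂ) := by
      ext i
      simp [Finset.sum_apply, Pi.single_apply]
    conv_lhs => rw [hv]
    simp [map_sum, h, Finset.sum_apply, Pi.single_apply, mul_comm]
  · rintro ⟨σ, a, ha, h⟩
    refine ⟨σ, a, ha, by simp [← Finset.prod_pow, ha], fun j => ?_⟩
    ext i
    obtain ⟨k, rfl⟩ := σ.surjective i
    rw [h]
    by_cases e : k = j <;> simp [e]

theorem Gmpn_one_mul_mem {u w : (Fin n → ℂ) ≃ₗ[ℂ] (Fin n → ℂ)} (hu : u ∈ Gmpn m 1 n)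
    (hw : w ∈ Gmpn m 1 n) : u * w ∈ Gmpn m 1 n := by
  rw [mem_Gmpn_one_iff] at *
  obtain ⟨σ, a, ha, hu⟩ := hu
  obtain ⟨τ, b, hb, hw⟩ := hw
  exact ⟨σ * τ, fun j => a (τ j) * b j, fun i => by simp [mul_pow, ha, hb],
    fun v j => by simp [hu, hw, mul_assoc]⟩

theorem Gmpn_one_inv_mem {w : (Fin n → ℂ) ≃ₗ[ℂ] (Fin n → ℂ)} (hm : m ≠ 0)
    (hw : w ∈ Gmpn m 1 n) : w⁻¹ ∈ Gmpn m 1 n := by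
  rw [mem_Gmpn_one_iff] at *
  obtain ⟨σ, a, ha, hw⟩ := hw
  refine ⟨σ⁻¹, fun j => (a (σ⁻¹ j))⁻¹, fun i => by simp [ha], fun v j => ?_⟩
  have h0 : a (σ⁻¹ j) ≠ 0 := fun h => by
    have h' := ha (σ⁻¹ j)
    rw [h, zero_pow hm] at h'
    exact zero_ne_one h'
  have h := hw (w⁻¹ v) (σ⁻¹ j)
  rw [← LinearEquiv.mul_apply, mul_inv_cancel, LinearEquiv.coe_one, id,
    show σ (σ⁻¹ j) = j from σ.apply_symm_apply j] at h
  rw [h, inv_mul_cancel_left₀ h0]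

theorem Gmpn_one_one_mem : (1 : (Fin n → ℂ) ≃ₗ[ℂ] (Fin n → ℂ)) ∈ Gmpn m 1 n :=
  mem_Gmpn_one_iff.2 ⟨1, 1, by simp, by simp⟩

theorem Gmpn_one_finite_and_ncard_le (hm : m ≠ 0) :
    (Gmpn m 1 n).Finite ∧ (Gmpn m 1 n).ncard ≤ n.factorial * m ^ n := by
  have : NeZero m := ⟨hm⟩
  choose σ a ha h using fun w : Gmpn m 1 n => mem_Gmpn_one_iff.1 w.2
  have hf : Function.Injective
      (fun w => (σ w, fun i => rootsOfUnity.mkOfPowEq (a w i) (ha w i)) :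
        Gmpn m 1 n → Equiv.Perm (Fin n) × (Fin n → rootsOfUnity m ℂ)) := by
    intro u w e
    simp only [Prod.mk.injEq] at e
    have ea : a u = a w := by
      ext i
      have := congrArg (fun z : rootsOfUnity m ℂ => ((z : ℂˣ) : ℂ)) (congrFun e.2 i)
      simpa using this
    refine Subtype.ext (LinearEquiv.ext fun v => funext fun i => ?_)
    obtain ⟨k, rfl⟩ := (σ u).surjective i
    rw [h u, e.1, h w, ea]
  have : Finite (Gmpn m 1 n) := Finite.of_injective _ hf
  refine ⟨Set.toFinite _, ?_⟩
  have := Nat.card_le_card_of_injective _ hf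
  rw [Nat.card_prod, Nat.card_perm, Nat.card_fun] at this
  rwa [Complex.card_rootsOfUnity, Nat.card_coe_set_eq,
    Nat.card_fin] at this

/-- The automorphism exchanging the coordinates `i` and `j` up to the scalars `z` and `z⁻¹`;
for `i = j` it multiplies the coordinate `j` by `z`. -/
def twistedSwap (i j : Fin n) (z : ℂˣ) : (Fin n → ℂ) ≃ₗ[ℂ] (Fin n → ℂ) where
  toFun v k := if k = j then z * v i else if k = i then (z⁻¹ : ℂˣ) * v j else v k
  invFun v k := if k = i then (z⁻¹ : ℂˣ) * v j else if k = j then z * v i else v k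
  map_add' u v := by
    ext k
    simp only [Pi.add_apply]
    split_ifs <;> ring
  map_smul' c v := by
    ext k
    simp only [Pi.smul_apply, smul_eq_mul, RingHom.id_apply]
    split_ifs <;> ring
  left_inv v := by
    ext k
    simp only
    split_ifs <;> simp_all
  right_inv v := by
    ext k
    simp only
    split_ifs <;> simp_all

variable {i j : Fin n} {z : ℂˣ}

theorem twistedSwap_apply (v : Fin n → ℂ) (k : Fin n) : twistedSwap i j z v k =
    if k = j then z * v i else if k = i then (z⁻¹ : ℂˣ) * v j else v k := rfl

theorem twistedSwap_self_one : twistedSwap j j 1 = 1 := by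
  ext v k
  simp only [twistedSwap_apply]
  split_ifs <;> simp_all

theorem twistedSwap_apply_of_lt (hij : i ≤ j) (v : Fin n → ℂ) {k : Fin n} (hk : j < k) :
    twistedSwap i j z v k = v k := by
  rw [twistedSwap_apply, if_neg hk.ne', if_neg (hij.trans_lt hk).ne']

theorem twistedSwap_apply_eq_self {v : Fin n → ℂ} (h : twistedSwap i j z v j = v j) :
    twistedSwap i j z v = v := by
  have h' : z * v i = v j := by simpa [twistedSwap_apply] using h
  ext k
  simp only [twistedSwap_apply]
  split_ifs with h1 h2
  · rw [h', h1]
  · rw [← h', h2, Units.inv_mul_cancel_left]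
  · rfl

theorem twistedSwap_injective {i' : Fin n} {z' : ℂˣ}
    (h : ∀ v, twistedSwap i j z v j = twistedSwap i' j z' v j) : i = i' ∧ z = z' := by
  have h1 := h (Pi.single i 1)
  simp only [twistedSwap_apply, if_true, Pi.single_apply] at h1
  by_cases e : i' = i
  · exact ⟨e.symm, Units.ext (by simpa [e] using h1)⟩
  · simp [e] at h1

theorem twistedSwap_mem (hz : z ^ m = 1) : twistedSwap i j z ∈ Gmpn m 1 n := by
  have hz' : (z : ℂ) ^ m = 1 := by rw [← Units.val_pow_eq_pow_val, hz, Units.val_one]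
  refine mem_Gmpn_one_iff.2 ⟨Equiv.swap i j,
    fun k => if k = i then z else if k = j then (z⁻¹ : ℂˣ) else 1, fun k => ?_, fun v k => ?_⟩
  · dsimp only
    split_ifs <;> simp [hz']
  · simp only [twistedSwap_apply, Equiv.swap_apply_def]
    split_ifs <;> simp_all

theorem twistedSwap_isReflection (h : twistedSwap i j z ≠ 1) : IsReflection (twistedSwap i j z) := by
  refine le_antisymm ?_ (Nat.one_le_iff_ne_zero.2 fun h0 => h (eq_one_of_fixCodim_eq_zero h0))
  rw [fixCodim_eq_finrank_range]
  refine (Submodule.finrank_mono (t := Submodule.span ℂ {(fun k =>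
    if k = j then 1 else if k = i then -(z⁻¹ : ℂˣ) else 0 : Fin n → ℂ)}) ?_).trans
    ((finrank_span_le_card _).trans (by simp))
  rintro _ ⟨v, rfl⟩
  refine Submodule.mem_span_singleton.2 ⟨z * v i - v j, ?_⟩
  ext k
  simp only [Pi.smul_apply, smul_eq_mul, LinearMap.sub_apply, Pi.sub_apply,
    LinearEquiv.coe_coe, twistedSwap_apply, Module.End.one_apply]
  split_ifs with h1 h2
  · rw [h1, mul_one]
  · have := z.inv_mul
    rw [h2]
    linear_combination (-v i) * this
  · simp

end Monomial

section Claw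

variable {m n : ℕ}

/-- A primitive `m`-th root of unity. -/
def primitiveUnit (m : ℕ) : ℂˣ :=
  Units.mk0 (Complex.exp (2 * Real.pi * Complex.I / m)) (Complex.exp_ne_zero _)

theorem isPrimitiveRoot_primitiveUnit (hm : m ≠ 0) : IsPrimitiveRoot (primitiveUnit m) m :=
  IsPrimitiveRoot.coe_units_iff.1 (Complex.isPrimitiveRoot_exp m hm)

/-- The identity and the reflections of `G(m,1,n)` involving the coordinate `j` and no later
coordinate, indexed by the claw poset `C_{(j+1)m}`. -/
def clawRefl (j : Fin n) (c : Fin ((j.1 + 1) * m)) : (Fin n → ℂ) ≃ₗ[ℂ] (Fin n → ℂ) :=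
  twistedSwap ⟨j.1 - c.1 / m, (Nat.sub_le _ _).trans_lt j.2⟩ j (primitiveUnit m ^ (c.1 % m))

theorem clawRefl_of_val_eq_zero {j : Fin n} {c : Fin ((j.1 + 1) * m)} (hc : c.1 = 0) :
    clawRefl j c = 1 := by
  simp [clawRefl, hc, twistedSwap_self_one]

theorem clawRefl_injective (hm : m ≠ 0) {j : Fin n} {c d : Fin ((j.1 + 1) * m)}
    (h : ∀ v, clawRefl j c v j = clawRefl j d v j) : c = d := by
  obtain ⟨h1, h2⟩ := twistedSwap_injective h
  have hpos := Nat.pos_of_ne_zero hm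
  have h3 := (isPrimitiveRoot_primitiveUnit hm).pow_inj (Nat.mod_lt _ hpos) (Nat.mod_lt _ hpos) h2
  have hc : c.1 / m < j.1 + 1 := Nat.div_lt_of_lt_mul (c.2.trans_eq (mul_comm _ _))
  have hd : d.1 / m < j.1 + 1 := Nat.div_lt_of_lt_mul (d.2.trans_eq (mul_comm _ _))
  have h4 : c.1 / m = d.1 / m := by
    have := congrArg Fin.val h1
    simp only at this
    omega
  exact Fin.ext (by rw [← Nat.div_add_mod c.1 m, ← Nat.div_add_mod d.1 m, h3, h4])

theorem clawRefl_eq_one_iff (hm : m ≠ 0) {j : Fin n} {c : Fin ((j.1 + 1) * m)} :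
    clawRefl j c = 1 ↔ c.1 = 0 := by
  refine ⟨fun h => ?_, clawRefl_of_val_eq_zero⟩
  have h0 : 0 < (j.1 + 1) * m := Nat.mul_pos (Nat.succ_pos _) (Nat.pos_of_ne_zero hm)
  have := clawRefl_injective hm (c := c) (d := ⟨0, h0⟩) fun v => by
    rw [h, clawRefl_of_val_eq_zero (c := ⟨0, h0⟩) rfl]
  rw [this]

theorem clawRefl_mem (hm : m ≠ 0) (j : Fin n) (c : Fin ((j.1 + 1) * m)) :
    clawRefl j c ∈ Gmpn m 1 n :=
  twistedSwap_mem (by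
    rw [← pow_mul, mul_comm, pow_mul, (isPrimitiveRoot_primitiveUnit hm).pow_eq_one, one_pow])

theorem clawRefl_apply_of_lt {j k : Fin n} (c : Fin ((j.1 + 1) * m)) (v : Fin n → ℂ)
    (hk : j < k) : clawRefl j c v k = v k :=
  twistedSwap_apply_of_lt (Fin.le_def.2 (Nat.sub_le _ _)) v hk

theorem eq_zero_of_clawRefl_apply (hm : m ≠ 0) {j : Fin n} {c : Fin ((j.1 + 1) * m)}
    (hc : c.1 ≠ 0) {v : Fin n → ℂ} (hv : ∀ k < j, v k = 0) (h : clawRefl j c v = v) :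
    v j = 0 := by
  by_contra hj
  have h1 := congrFun h j
  by_cases hq : (⟨j.1 - c.1 / m, (Nat.sub_le _ _).trans_lt j.2⟩ : Fin n) < j
  · simp only [clawRefl, twistedSwap_apply, if_true, hv _ hq, mul_zero] at h1
    exact hj h1.symm
  · have e : (⟨j.1 - c.1 / m, (Nat.sub_le _ _).trans_lt j.2⟩ : Fin n) = j :=
      le_antisymm (Fin.le_def.2 (Nat.sub_le _ _)) (not_lt.1 hq)
    simp only [clawRefl, e, twistedSwap_apply, if_true] at h1
    have hz : primitiveUnit m ^ (c.1 % m) = 1 :=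
      Units.ext (mul_right_cancel₀ hj (by simpa using h1))
    refine hc ((clawRefl_eq_one_iff hm).1 ?_)
    rw [clawRefl, e, hz, twistedSwap_self_one]

/-- The sequence of reflections attached to an element of the product of claws. -/
def clawSeq (x : ∀ j : Fin n, Fin ((j.1 + 1) * m)) (k : ℕ) : (Fin n → ℂ) ≃ₗ[ℂ] (Fin n → ℂ) :=
  if h : k < n then clawRefl ⟨k, h⟩ (x ⟨k, h⟩) else 1

/-- The product of the first `N` reflections attached to an element of the product of claws. -/
def clawProd (x : ∀ j : Fin n, Fin ((j.1 + 1) * m)) (N : ℕ) : (Fin n → ℂ) ≃ₗ[ℂ] (Fin n → ℂ) :=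
  ((List.range N).map (clawSeq x)).prod

variable (x y : ∀ j : Fin n, Fin ((j.1 + 1) * m))

theorem clawSeq_val (j : Fin n) : clawSeq x j = clawRefl j (x j) := by
  simp [clawSeq]

theorem clawProd_succ (j : Fin n) : clawProd x (j + 1) = clawProd x j * clawRefl j (x j) := by
  simp [clawProd, List.range_succ, clawSeq_val]

theorem clawSeq_mem (hm : m ≠ 0) (k : ℕ) : clawSeq x k ∈ Gmpn m 1 n := by
  unfold clawSeq
  split_ifs
  exacts [clawRefl_mem hm _ _, Gmpn_one_one_mem]

theorem clawProd_mem (hm : m ≠ 0) (N : ℕ) : clawProd x N ∈ Gmpn m 1 n := by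
  refine List.prod_induction (· ∈ Gmpn m 1 n) (fun _ _ => Gmpn_one_mul_mem) Gmpn_one_one_mem ?_
  simp only [List.mem_map]
  rintro _ ⟨k, -, rfl⟩
  exact clawSeq_mem x hm k

theorem clawSeq_eq_one_or (hm : m ≠ 0) (k : ℕ) :
    clawSeq x k = 1 ∨ clawSeq x k ∈ {t | t ∈ Gmpn m 1 n ∧ IsReflection t} := by
  refine or_iff_not_imp_left.2 fun h => ⟨clawSeq_mem x hm k, ?_⟩
  unfold clawSeq at h ⊢
  split_ifs at h ⊢
  exacts [twistedSwap_isReflection h, absurd rfl h]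

theorem clawProd_apply_of_le (v : Fin n → ℂ) (k : Fin n) {N : ℕ} (hN : N ≤ k) :
    clawProd x N v k = v k := by
  induction N generalizing v with
  | zero => simp [clawProd]
  | succ N ih =>
    have h : N < n := by omega
    rw [clawProd_succ x ⟨N, h⟩, LinearEquiv.mul_apply, ih _ (by omega),
      clawRefl_apply_of_lt _ _ (Fin.lt_def.2 (Nat.lt_of_succ_le hN))]

theorem clawProd_succ_apply_self (v : Fin n → ℂ) (j : Fin n) :
    clawProd x (j + 1) v j = clawRefl j (x j) v j := by
  rw [clawProd_succ, LinearEquiv.mul_apply, clawProd_apply_of_le x _ j le_rfl]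

theorem clawRefl_apply_eq_self_of_clawProd {v : Fin n → ℂ} {N : ℕ} (hN : N ≤ n)
    (h : clawProd x N v = v) (j : Fin n) (hj : j < N) : clawRefl j (x j) v = v := by
  induction N with
  | zero => omega
  | succ N ih =>
    have h1 := congrFun h ⟨N, hN⟩
    rw [clawProd_succ_apply_self x v ⟨N, hN⟩] at h1
    have h2 : clawRefl ⟨N, hN⟩ (x ⟨N, hN⟩) v = v := twistedSwap_apply_eq_self h1
    rw [clawProd_succ x ⟨N, hN⟩, LinearEquiv.mul_apply, h2] at h
    rcases (Nat.lt_succ_iff_lt_or_eq.1 hj) with hj | rfl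
    · exact ih (by omega) h hj
    · exact h2

variable {x y} in
theorem eq_of_clawProd_eq (hm : m ≠ 0) {N : ℕ} (hN : N ≤ n) (h : clawProd x N = clawProd y N)
    (j : Fin n) (hj : j < N) : x j = y j := by
  induction N with
  | zero => omega
  | succ N ih =>
    have h1 : x ⟨N, hN⟩ = y ⟨N, hN⟩ := clawRefl_injective hm fun v => by
      rw [← clawProd_succ_apply_self, ← clawProd_succ_apply_self, h]
    rw [clawProd_succ x ⟨N, hN⟩, clawProd_succ y ⟨N, hN⟩, h1] at h
    rcases (Nat.lt_succ_iff_lt_or_eq.1 hj) with hj | rfl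
    · exact ih (by omega) (mul_right_cancel h) hj
    · exact h1

theorem clawProd_bijOn (hm : m ≠ 0) :
    Set.BijOn (fun x : ∀ j : Fin n, Fin ((j.1 + 1) * m) => clawProd x n) Set.univ
      (Gmpn m 1 n) := by
  have hinj : Function.Injective
      (fun x : ∀ j : Fin n, Fin ((j.1 + 1) * m) => clawProd x n) :=
    fun x y h => funext fun j => eq_of_clawProd_eq hm le_rfl h j j.2
  refine ⟨fun x _ => clawProd_mem x hm n, hinj.injOn, ?_⟩
  obtain ⟨hfin, hcard⟩ := Gmpn_one_finite_and_ncard_le (n := n) hm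
  have hsub : (fun x : ∀ j : Fin n, Fin ((j.1 + 1) * m) => clawProd x n) '' Set.univ ⊆
      Gmpn m 1 n := Set.image_subset_iff.2 fun x _ => clawProd_mem x hm n
  refine (Set.eq_of_subset_of_ncard_le hsub (hcard.trans ?_) hfin).ge
  rw [Set.ncard_image_of_injective _ hinj, Set.ncard_univ, Nat.card_eq_fintype_card,
    Fintype.card_pi]
  simp only [Fintype.card_fin, Finset.prod_mul_distrib, Finset.prod_const, Finset.card_univ]
  rw [Fin.prod_univ_eq_prod_range (fun j => j + 1) n, Finset.prod_range_add_one_eq_factorial]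

theorem clawRank_eq_sum : clawRank x = ∑ j, if (x j : ℕ) = 0 then 0 else 1 := by
  rw [clawRank, Set.ncard_eq_toFinset_card', Set.toFinset_ofPred, Finset.card_filter]
  simp only [ne_eq, ite_not]

theorem clawRank_le_fixCodim (hm : m ≠ 0) : clawRank x ≤ fixCodim (clawProd x n) := by
  let S : Finset (Fin n) := {j | (x j : ℕ) ≠ 0}
  have hS : clawRank x = S.card := by
    rw [clawRank, Set.ncard_eq_toFinset_card', Set.toFinset_ofPred]
  let K := LinearMap.ker ((clawProd x n : (Fin n → ℂ) →ₗ[ℂ] (Fin n → ℂ)) - 1)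
  let f : K →ₗ[ℂ] ((Sᶜ : Finset (Fin n)) → ℂ) :=
    (LinearMap.funLeft ℂ ℂ (Subtype.val : (Sᶜ : Finset (Fin n)) → Fin n)) ∘ₗ K.subtype
  have hf : Function.Injective f := by
    refine (injective_iff_map_eq_zero f).2 fun ⟨v, hv⟩ h => Subtype.ext (funext fun j => ?_)
    have hv' : clawProd x n v = v := by
      simpa [K, LinearMap.mem_ker, sub_eq_zero] using hv
    induction j using WellFoundedLT.induction with
    | ind j ih =>
      by_cases hj : (x j : ℕ) = 0
      · exact congrFun h ⟨j, by simp [S, hj]⟩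
      · exact eq_zero_of_clawRefl_apply hm hj ih
          (clawRefl_apply_eq_self_of_clawProd x le_rfl hv' j j.2)
  have h1 := LinearMap.finrank_le_finrank_of_injective hf
  rw [finrank_fintype_fun_eq_card, Fintype.card_coe, Finset.card_compl, Fintype.card_fin] at h1
  have h2 : S.card ≤ n := by simpa using S.card_le_univ
  rw [hS, fixCodim, finrank_fintype_fun_eq_card, Fintype.card_fin]
  change S.card ≤ n - finrank ℂ K
  omega

variable {x y} in
theorem exists_reflections_prod_eq (hm : m ≠ 0) (hxy : clawLe x y) :
    ∃ l : List ((Fin n → ℂ) ≃ₗ[ℂ] (Fin n → ℂ)), l.length + clawRank x = clawRank y ∧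
      (∀ t ∈ l, t ∈ Gmpn m 1 n ∧ IsReflection t) ∧
      l.prod = (clawProd x n)⁻¹ * clawProd y n := by
  classical
  obtain ⟨l, hl, hT, hp⟩ := exists_list_prod_eq_inv_mul
    {t | t ∈ Gmpn m 1 n ∧ IsReflection t} (clawSeq x) (clawSeq y)
    (fun k t ht => ⟨Gmpn_one_mul_mem (Gmpn_one_mul_mem (Gmpn_one_inv_mem hm (clawSeq_mem x hm k))
      ht.1) (clawSeq_mem x hm k), (fixCodim_conj _ t).trans ht.2⟩)
    (clawSeq_eq_one_or y hm)
    (fun k => by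
      unfold clawSeq
      split_ifs with hk
      · exact (hxy ⟨k, hk⟩).imp (congrArg _) clawRefl_of_val_eq_zero
      · exact Or.inl rfl) n
  refine ⟨l, ?_, hT, hp⟩
  rw [hl, Finset.sum_range, clawRank_eq_sum, clawRank_eq_sum, ← Finset.sum_add_distrib]
  refine Finset.sum_congr rfl fun j _ => ?_
  rw [clawSeq_val, clawSeq_val]
  rcases hxy j with h | h
  · simp [h]
  · rw [clawRefl_of_val_eq_zero h]
    simp [h, eq_comm (a := (1 : (Fin n → ℂ) ≃ₗ[ℂ] (Fin n → ℂ))), clawRefl_eq_one_iff hm]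

theorem exists_reflections_prod_eq_clawProd (hm : m ≠ 0) :
    ∃ l : List ((Fin n → ℂ) ≃ₗ[ℂ] (Fin n → ℂ)), l.length = clawRank x ∧
      (∀ t ∈ l, t ∈ Gmpn m 1 n ∧ IsReflection t) ∧ l.prod = clawProd x n := by
  let o : ∀ j : Fin n, Fin ((j.1 + 1) * m) :=
    fun j => ⟨0, Nat.mul_pos (Nat.succ_pos _) (Nat.pos_of_ne_zero hm)⟩
  have ho : clawProd o n = 1 := List.prod_eq_one fun t ht => by
    obtain ⟨k, -, rfl⟩ := List.mem_map.1 ht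
    unfold clawSeq
    split_ifs
    exacts [clawRefl_of_val_eq_zero rfl, rfl]
  have hr : clawRank o = 0 := by simp [clawRank, o]
  have h := exists_reflections_prod_eq hm (x := o) (y := x) fun j => Or.inr rfl
  simpa only [ho, hr, inv_one, one_mul, add_zero] using h

theorem reflLen_clawProd (hm : m ≠ 0) : reflLen (Gmpn m 1 n) (clawProd x n) = clawRank x := by
  obtain ⟨l, hl, hT, hp⟩ := exists_reflections_prod_eq_clawProd x hm
  exact le_antisymm (hl ▸ reflLen_le hT hp)
    ((clawRank_le_fixCodim x hm).trans (fixCodim_le_reflLen hT hp))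

variable {x y} in
theorem preLe_clawProd (hm : m ≠ 0) (hxy : clawLe x y) :
    preLe (Gmpn m 1 n) (clawProd x n) (clawProd y n) := by
  obtain ⟨l, hl, hT, hp⟩ := exists_reflections_prod_eq hm hxy
  obtain ⟨lx, hlx, hTx, hpx⟩ := exists_reflections_prod_eq_clawProd x hm
  have h1 := reflLen_le hT hp
  have h2 := fixCodim_le_reflLen hT hp
  have h3 := fixCodim_mul_le (clawProd x n) ((clawProd x n)⁻¹ * clawProd y n)
  rw [mul_inv_cancel_left] at h3
  have h4 := clawRank_le_fixCodim y hm
  have h5 := fixCodim_le_reflLen hTx hpx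
  have h6 := reflLen_clawProd x hm
  rw [preLe, reflLen_clawProd y hm]
  omega

end Claw

/-- The absolute order on `G(m,1,n)` has a coarsening isomorphic to
`C_m × C_{2m} × ⋯ × C_{nm}`. -/
theorem statement3 (m n : ℕ) (hm : 1 ≤ m) (hn : 1 ≤ n) :
    ∃ φ : (∀ j : Fin n, Fin ((j.1 + 1) * m)) → ((Fin n → ℂ) ≃ₗ[ℂ] (Fin n → ℂ)),
      Set.BijOn φ Set.univ (Gmpn m 1 n) ∧
      (∀ x, clawRank x = reflLen (Gmpn m 1 n) (φ x)) ∧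
      (∀ x y, clawLe x y → preLe (Gmpn m 1 n) (φ x) (φ y)) :=
  have hm0 : m ≠ 0 := Nat.one_le_iff_ne_zero.1 hm
  ⟨fun x => clawProd x n, clawProd_bijOn hm0, fun x => (reflLen_clawProd x hm0).symm,
    fun _ _ hxy => preLe_clawProd hm0 hxy⟩

end
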